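/- arXiv:2005.05907 — 4 statements merged into one kernel-verified Lean document; each statement's English description precedes it below -/
import Mathlib

section
/- Let A = (Q, δ) and C = (T, η) be deterministic complete semi-automata over the same finite alphabet Σ, and let I ⊆ Σ* be exactly the set of synchronizing words of C. Let L ⊆ Σ* be any language and let D = (Q × T, γ) be the product automaton with γ((q, t), x) = (δ(q, x), η(t, x)). Then D has a synchronizing word in L if and only if A has a synchronizing word in L ∩ I. -/
/-- Extended transition function of a deterministic complete semi-automaton. -/
def run {Q σ : Type*} (δ : Q → σ → Q) (q : Q) (w : List σ) : Q := w.foldl δ q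

/-- A word is synchronizing for the DCSA `(Q, δ)` if it maps every state to one state. -/
def IsSync {Q σ : Type*} (δ : Q → σ → Q) (w : List σ) : Prop := ∃ q, ∀ p, run δ p w = q

theorem run_prod {σ Q T : Type*} {δ : Q → σ → Q} {η : T → σ → T} {γ : Q × T → σ → Q × T}
    (hγ : ∀ (p : Q × T) (x : σ), γ p x = (δ p.1 x, η p.2 x)) (p : Q × T) (w : List σ) :
    run γ p w = (run δ p.1 w, run η p.2 w) := by
  induction w generalizing p with
  | nil => rfl
  | cons x w ih =>
    change run γ (γ p x) w = (run δ (δ p.1 x) w, run η (η p.2 x) w)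
    rw [ih, hγ]

theorem isSync_prod_iff {σ Q T : Type*} [Nonempty Q] [Nonempty T]
    {δ : Q → σ → Q} {η : T → σ → T} {γ : Q × T → σ → Q × T}
    (hγ : ∀ (p : Q × T) (x : σ), γ p x = (δ p.1 x, η p.2 x)) (w : List σ) :
    IsSync γ w ↔ IsSync δ w ∧ IsSync η w := by
  simp only [IsSync, run_prod hγ, Prod.forall, Prod.exists, Prod.mk.injEq, forall_and,
    forall_const, exists_and_left, exists_and_right]

theorem stmt_6 {σ : Type*} [Fintype σ] {Q T : Type*}
    [Fintype Q] [Nonempty Q] [Fintype T] [Nonempty T]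
    (δ : Q → σ → Q) (η : T → σ → T)
    (I : Set (List σ)) (hI : I = {w | IsSync η w})
    (L : Set (List σ))
    (γ : Q × T → σ → Q × T)
    (hγ : ∀ (p : Q × T) (x : σ), γ p x = (δ p.1 x, η p.2 x)) :
    (∃ w ∈ L, IsSync γ w) ↔ (∃ w ∈ L ∩ I, IsSync δ w) := by
  subst hI
  simp only [isSync_prod_iff hγ, Set.mem_inter_iff, Set.mem_ofPred_eq, and_assoc,
    and_comm (a := IsSync δ _)]
end

section
/- Let Σ be a finite nonempty alphabet and let I ⊆ Σ* be a nonempty regular language that is a two-sided ideal, i.e., I = I·Σ* and I = Σ*·I. Then there exists a deterministic complete semi-automaton over Σ (with finitely many states) whose set of synchronizing words is exactly I. -/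
/-- Concatenation of two languages. -/
def conc {σ : Type*} (L M : Set (List σ)) : Set (List σ) :=
  {x | ∃ u ∈ L, ∃ v ∈ M, x = u ++ v}

theorem Language.run_toDFA_val {σ : Type*} (L : Language σ) (s : Set.range L.leftQuotient)
    (w : List σ) : (run L.toDFA.step s w).val = s.val.leftQuotient w := by
  induction w generalizing s with
  | nil => rfl
  | cons a w ih =>
    rw [show run L.toDFA.step s (a :: w) = run L.toDFA.step (L.toDFA.step s a) w from rfl, ih,
      Language.step_toDFA, ← Language.leftQuotient_append, List.singleton_append]

/-- The synchronizing words of the left quotient automaton of a nonempty two-sided ideal are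
exactly the words of the ideal. -/
theorem isSync_toDFA_iff {σ : Type*} {L : Language σ} (hne : ∃ v, v ∈ L)
    (hright : ∀ u v, u ∈ L → u ++ v ∈ L) (hleft : ∀ u v, v ∈ L → u ++ v ∈ L) (w : List σ) :
    IsSync L.toDFA.step w ↔ w ∈ L := by
  constructor
  · rintro ⟨q, hq⟩
    obtain ⟨v, hv⟩ := hne
    have h : L.leftQuotient w = (L.leftQuotient v).leftQuotient w := by
      rw [← L.start_toDFA, ← L.run_toDFA_val, L.start_toDFA,
        ← L.run_toDFA_val ⟨L.leftQuotient v, v, rfl⟩, hq, hq]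
    have hmem : [] ∈ (L.leftQuotient v).leftQuotient w := by
      simpa using hright v w hv
    simpa [← h] using hmem
  · intro hw
    have h : ∀ u, (L.leftQuotient u).leftQuotient w = L.leftQuotient w := by
      intro u
      ext y
      simp only [Language.mem_leftQuotient]
      exact iff_of_true (hleft u _ (hright w y hw)) (hright w y hw)
    refine ⟨⟨L.leftQuotient w, w, rfl⟩, ?_⟩
    rintro ⟨_, u, rfl⟩
    exact Subtype.ext ((L.run_toDFA_val _ w).trans (h u))

theorem stmt_7 {σ : Type} [Fintype σ] [Nonempty σ] (I : Set (List σ))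
    (hne : I.Nonempty)
    (hreg : ∃ (P : Type) (_ : Fintype P) (M : DFA σ P), M.accepts = I)
    (hright : conc I (Set.univ : Set (List σ)) = I)
    (hleft : conc (Set.univ : Set (List σ)) I = I) :
    ∃ (Q : Type) (_ : Fintype Q) (_ : Nonempty Q) (δ : Q → σ → Q),
      {w | IsSync δ w} = I := by
  have hfin : (Set.range (Language.leftQuotient (α := σ) I)).Finite :=
    Language.IsRegular.finite_range_leftQuotient hreg
  refine ⟨_, hfin.fintype, ⟨(Language.toDFA (α := σ) I).start⟩, (Language.toDFA (α := σ) I).step,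
    Set.ext fun w => isSync_toDFA_iff hne (fun u v hu => ?_) (fun u v hv => ?_) w⟩
  · exact hright.subset ⟨u, hu, v, trivial, rfl⟩
  · exact hleft.subset ⟨u, trivial, v, hv, rfl⟩
end

section
/- Let B be a deterministic finite automaton over a finite alphabet Σ with state set P, transition function μ, start state p0 and final state set F, and let p ∈ P lie in the same strongly connected component as p0, i.e., there exist words u, v ∈ Σ* with μ(p, u) = p0 and μ(p0, v) = p. Then for every deterministic complete semi-automaton A over Σ: A has a synchronizing word w with μ(p0, w) ∈ F if and only if A has a synchronizing word w' with μ(p, w') ∈ F. -/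
theorem run_append {Q σ : Type*} (δ : Q → σ → Q) (q : Q) (u w : List σ) :
    run δ q (u ++ w) = run δ (run δ q u) w :=
  List.foldl_append

theorem IsSync.append_left {Q σ : Type*} {δ : Q → σ → Q} {w : List σ} (h : IsSync δ w)
    (u : List σ) : IsSync δ (u ++ w) := by
  obtain ⟨q, hq⟩ := h
  exact ⟨q, fun p => by rw [run_append, hq]⟩

theorem exists_isSync_run_mem_of_run_eq {P Q σ : Type*} {μ : P → σ → P} {δ : Q → σ → Q}
    {F : Set P} {p q : P} {u : List σ} (hu : run μ p u = q)
    (h : ∃ w, IsSync δ w ∧ run μ q w ∈ F) : ∃ w, IsSync δ w ∧ run μ p w ∈ F := by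
  obtain ⟨w, hw, hF⟩ := h
  exact ⟨u ++ w, hw.append_left u, by rwa [run_append, hu]⟩

theorem stmt_9 {σ : Type*} [Fintype σ] {P : Type*} [Fintype P]
    (μ : P → σ → P) (p0 : P) (F : Set P) (p : P)
    (hup : ∃ u : List σ, run μ p u = p0)
    (hdown : ∃ v : List σ, run μ p0 v = p) :
    ∀ (Q : Type) [Fintype Q] [Nonempty Q] (δ : Q → σ → Q),
      (∃ w : List σ, IsSync δ w ∧ run μ p0 w ∈ F) ↔
      (∃ w' : List σ, IsSync δ w' ∧ run μ p w' ∈ F) := by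
  intro Q _ _ δ
  obtain ⟨u, hu⟩ := hup
  obtain ⟨v, hv⟩ := hdown
  exact ⟨exists_isSync_run_mem_of_run_eq hu, exists_isSync_run_mem_of_run_eq hv⟩
end

section
/- Let Σ be a finite alphabet, u ∈ Σ* a nonempty word, and C ⊆ Σ* a set such that C is prefix-free, C ∪ {u} is prefix-free, C* ∩ Σ*·{u}·Σ* = ∅, and Suff({u}) ∩ Pref({u}) ⊆ {ε, u}. Then for every word w₁ ∈ Pref(C ∪ {u}) with w₁ ∉ C ∪ {u} and w₁ ≠ ε, the following hold: (a) w₁·u ∉ (C ∪ {u})*; and (b) there exist no words w₃ ∈ (C ∪ {u})* and w₂ ∈ Pref(C ∪ {u}) with w₂ ∉ C ∪ {u}, w₂ ≠ ε, and w₁·u = w₃·w₂. -/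
/-- `Prefixes L` is the set of prefixes of words in `L`. -/
def Prefixes {σ : Type*} (L : Set (List σ)) : Set (List σ) := {w | ∃ u, w ++ u ∈ L}

/-- Kleene star of a language. -/
def kstarSet {σ : Type*} (L : Set (List σ)) : Set (List σ) :=
  {x | ∃ W : List (List σ), (∀ w ∈ W, w ∈ L) ∧ x = W.flatten}

/-- A set of words is prefix-free if no element is a proper prefix of another. -/
def PrefixFree {σ : Type*} (C : Set (List σ)) : Prop :=
  ∀ x ∈ C, ∀ y ∈ C, x <+: y → x = y

/-- An occurrence of an unbordered word `u` in `w ++ u` either lies inside `w` or ends the word. -/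
lemma eq_nil_or_infix_of_append_eq {σ : Type*} {u w a b : List σ}
    (hsp : ∀ s : List σ, s <:+ u → s <+: u → s = [] ∨ s = u)
    (h : w ++ u = a ++ (u ++ b)) : b = [] ∨ u <:+: w := by
  rcases List.append_eq_append_iff.1 h with ⟨c, -, hc⟩ | ⟨c, rfl, hc⟩
  · left
    have hlen := congrArg List.length hc
    simp only [List.length_append] at hlen
    exact List.length_eq_zero_iff.1 (by omega)
  · rcases List.append_eq_append_iff.1 hc with ⟨d, rfl, -⟩ | ⟨e, he, he'⟩
    · exact Or.inr ⟨a, d, by simp⟩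
    · rcases hsp e ⟨c, he.symm⟩ ⟨b, he'.symm⟩ with rfl | rfl
      · exact Or.inr ⟨a, [], by simp [he]⟩
      · exact Or.inl (by simpa using he')

lemma mem_kstarSet_of_mem {σ : Type*} {C : Set (List σ)} {x : List σ} (hx : x ∈ C) :
    x ∈ kstarSet C :=
  ⟨[x], by simpa using hx, by simp⟩

lemma append_mem_kstarSet {σ : Type*} {C : Set (List σ)} {x y : List σ}
    (hx : x ∈ kstarSet C) (hy : y ∈ kstarSet C) : x ++ y ∈ kstarSet C := by
  obtain ⟨V, hV, rfl⟩ := hx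
  obtain ⟨W, hW, rfl⟩ := hy
  refine ⟨V ++ W, fun w hw => ?_, by simp⟩
  exact (List.mem_append.1 hw).elim (hV w) (hW w)

/-- A word of `(C ∪ {u})*` is in `C*` or factors through `u`. -/
lemma mem_kstarSet_union_singleton {σ : Type*} {C : Set (List σ)} {u x : List σ}
    (hx : x ∈ kstarSet (C ∪ {u})) :
    x ∈ kstarSet C ∨ ∃ a ∈ kstarSet (C ∪ {u}), ∃ b, x = a ++ (u ++ b) := by
  obtain ⟨W, hW, rfl⟩ := hx
  by_cases h : u ∈ W
  · obtain ⟨A, B, rfl⟩ := List.append_of_mem h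
    exact Or.inr ⟨A.flatten, ⟨A, fun w hw => hW w (by simp [hw]), rfl⟩, B.flatten, by simp⟩
  · exact Or.inl ⟨W, fun w hw => (hW w hw).resolve_right fun hwu => h (hwu ▸ hw), rfl⟩

/-- For a prefix-free `D`, a nonempty prefix of a word of `D` that lies in `D*` lies in `D`. -/
lemma PrefixFree.mem_of_mem_kstarSet {σ : Type*} {D : Set (List σ)} (hD : PrefixFree D)
    {w : List σ} (hw : w ∈ Prefixes D) (hne : w ≠ []) (hstar : w ∈ kstarSet D) : w ∈ D := by
  obtain ⟨t, ht⟩ := hw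
  obtain ⟨W, hW, rfl⟩ := hstar
  cases W with
  | nil => simp at hne
  | cons c W =>
    have hc := hW c (by simp)
    have h := hD c hc _ ht ⟨W.flatten ++ t, by simp⟩
    have hnil : W.flatten = [] := by
      have hlen := congrArg List.length h
      simp only [List.flatten_cons, List.length_append] at hlen
      exact List.length_eq_zero_iff.1 (by omega)
    simpa [hnil] using hc


theorem stmt_11 {σ : Type*} (u : List σ) (hu : u ≠ [])
    (C : Set (List σ))
    (hC : PrefixFree C) (hCu : PrefixFree (C ∪ {u}))
    (hdisj : ∀ v w : List σ, v ++ u ++ w ∉ kstarSet C)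
    (hsp : ∀ s : List σ, s <:+ u → s <+: u → s = [] ∨ s = u)
    (w₁ : List σ) (hw₁ : w₁ ∈ Prefixes (C ∪ {u}))
    (hw₁n : w₁ ∉ C ∪ {u}) (hw₁e : w₁ ≠ []) :
    (w₁ ++ u ∉ kstarSet (C ∪ {u})) ∧
    ¬ ∃ w₃ ∈ kstarSet (C ∪ {u}), ∃ w₂ ∈ Prefixes (C ∪ {u}),
        w₂ ∉ C ∪ {u} ∧ w₂ ≠ [] ∧ w₁ ++ u = w₃ ++ w₂ := by
  have hinf : ¬ u <:+: w₁ := by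
    rintro ⟨a, b, rfl⟩
    obtain ⟨t, ht | ht⟩ := hw₁
    · refine hdisj a (b ++ t) (mem_kstarSet_of_mem ?_)
      simpa using ht
    · have hlen := congrArg List.length (Set.mem_singleton_iff.1 ht)
      simp only [List.length_append] at hlen
      obtain rfl : a = [] := List.length_eq_zero_iff.1 (by omega)
      obtain rfl : b = [] := List.length_eq_zero_iff.1 (by omega)
      exact hw₁n (by simp)
  constructor
  · intro hstar
    rcases mem_kstarSet_union_singleton hstar with h | ⟨a, ha, b, h⟩
    · exact hdisj w₁ [] (by simpa using h)
    · obtain rfl := (eq_nil_or_infix_of_append_eq hsp h).resolve_right hinf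
      obtain rfl : w₁ = a := by simpa using h
      exact hw₁n (hCu.mem_of_mem_kstarSet hw₁ hw₁e ha)
  · rintro ⟨w₃, hw₃, w₂, ⟨t, ht⟩, hw₂n, hw₂e, heq⟩
    rcases mem_kstarSet_union_singleton hw₃ with h | ⟨a, -, b, rfl⟩
    · rcases ht with ht | ht
      · refine hdisj w₁ t ?_
        rw [heq, List.append_assoc]
        exact append_mem_kstarSet h (mem_kstarSet_of_mem ht)
      · have hpre : w₂ <+: u := ⟨t, ht⟩
        have hsuf : w₂ <:+ u :=
          List.suffix_of_suffix_length_le ⟨w₃, heq.symm⟩ ⟨w₁, rfl⟩ hpre.length_le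
        rcases hsp w₂ hsuf hpre with rfl | rfl
        · exact hw₂e rfl
        · exact hw₂n (by simp)
    · have h : w₁ ++ u = a ++ (u ++ (b ++ w₂)) := by simpa using heq
      exact hw₂e (List.append_eq_nil_iff.1
        ((eq_nil_or_infix_of_append_eq hsp h).resolve_right hinf)).2
end
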